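/- arXiv:2004.06597 — 4 statements merged into one kernel-verified Lean document; each statement's English description precedes it below -/
import Mathlib

section
/- Let I ⊆ R be an ideal, f ∈ R, and m a positive integer. Then f ∈ I if and only if f^[m] ∈ I^[m]. -/
/-- The `m`-th square power `f^[m] = f(X_1^m, …, X_n^m)` of a polynomial `f`. -/
noncomputable def sqPoly {n : ℕ} {K : Type*} [Field K] (m : ℕ)
    (f : MvPolynomial (Fin n) K) : MvPolynomial (Fin n) K :=
  MvPolynomial.aeval (fun i => (MvPolynomial.X i : MvPolynomial (Fin n) K) ^ m) f

/-- The `m`-th square power `I^[m] = ⟨f^[m] : f ∈ I⟩` of an ideal `I`. -/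
noncomputable def sqPow {n : ℕ} {K : Type*} [Field K] (m : ℕ)
    (I : Ideal (MvPolynomial (Fin n) K)) : Ideal (MvPolynomial (Fin n) K) :=
  I.map (MvPolynomial.aeval (fun i => (MvPolynomial.X i : MvPolynomial (Fin n) K) ^ m))

namespace MvPolynomial

variable {σ R : Type*} [CommSemiring R]

open Classical in
/-- The linear map sending a monomial `X ^ (p • d)` to `X ^ d`, and every monomial whose exponent
is not divisible by `p` to `0`. -/
noncomputable def contractExponents (p : ℕ) : MvPolynomial σ R →ₗ[R] MvPolynomial σ R :=
  (basisMonomials σ R).constr R fun d ↦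
    if ∀ i, p ∣ d i then monomial (d.mapRange (· / p) (Nat.zero_div p)) 1 else 0

open Classical in
theorem contractExponents_monomial (p : ℕ) (d : σ →₀ ℕ) (r : R) :
    contractExponents p (monomial d r) =
      if ∀ i, p ∣ d i then monomial (d.mapRange (· / p) (Nat.zero_div p)) r else 0 := by
  have h : contractExponents p (monomial d (1 : R)) =
      if ∀ i, p ∣ d i then monomial (d.mapRange (· / p) (Nat.zero_div p)) 1 else 0 := by
    simpa only [contractExponents, coe_basisMonomials] using
      (basisMonomials σ R).constr_basis R _ d
  rw [← mul_one r, ← smul_eq_mul, ← smul_monomial, map_smul, h]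
  split_ifs <;> simp [smul_monomial]

theorem contractExponents_one (p : ℕ) :
    contractExponents p (1 : MvPolynomial σ R) = 1 := by
  classical
  simpa using contractExponents_monomial p (0 : σ →₀ ℕ) (1 : R)

theorem contractExponents_mul_expand {p : ℕ} (hp : 0 < p) (g f : MvPolynomial σ R) :
    contractExponents p (g * expand p f) = contractExponents p g * f := by
  classical
  induction g using induction_on' with
  | add g₁ g₂ h₁ h₂ => simp [add_mul, h₁, h₂]
  | monomial a r =>
    induction f using induction_on' with
    | add f₁ f₂ h₁ h₂ => simp [mul_add, h₁, h₂]
    | monomial b s =>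
      have hdvd : (∀ i, p ∣ (a + p • b) i) ↔ ∀ i, p ∣ a i :=
        forall_congr' fun i ↦ by simp [Nat.dvd_add_left (dvd_mul_right p (b i))]
      rw [expand_monomial, monomial_mul, contractExponents_monomial, contractExponents_monomial,
        if_congr hdvd rfl rfl, ite_mul, zero_mul, monomial_mul]
      congr 3
      ext i
      simp [Nat.add_mul_div_left _ _ hp]

theorem comap_expand_map_expand {p : ℕ} (hp : 0 < p) (I : Ideal (MvPolynomial σ R)) :
    (I.map (expand p)).comap (expand p) = I := by
  refine le_antisymm (fun f hf ↦ ?_) Ideal.le_comap_map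
  have contract_mem : ∀ g ∈ I.map (expand p), contractExponents p g ∈ I := by
    intro g hg
    rw [Ideal.map] at hg
    induction hg using Submodule.closure_induction with
    | zero => simp
    | add g₁ g₂ _ _ h₁ h₂ => simpa using I.add_mem h₁ h₂
    | smul_mem a g hg =>
      obtain ⟨x, hx, rfl⟩ := hg
      simpa [contractExponents_mul_expand hp] using I.mul_mem_left _ hx
  have h := contract_mem (expand p f) hf
  rwa [← one_mul (expand p f), contractExponents_mul_expand hp, contractExponents_one,
    one_mul] at h

end MvPolynomial

/-- For an ideal `I ⊆ K[X_1,…,X_n]`, `f ∈ R` and a positive integer `m`,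
`f ∈ I` if and only if `f^[m] ∈ I^[m]`. -/
theorem mem_iff_sq_mem_sq (n : ℕ) (K : Type*) [Field K] (m : ℕ) (hm : 0 < m)
    (I : Ideal (MvPolynomial (Fin n) K)) (f : MvPolynomial (Fin n) K) :
    f ∈ I ↔ sqPoly m f ∈ sqPow m I := by
  have h := SetLike.ext_iff.mp (MvPolynomial.comap_expand_map_expand hm I) f
  exact h.symm
end

section
/- If f_1, …, f_r ∈ R is an R-regular sequence, then for any integer m ≥ 2, the sequence f_1^[m], …, f_r^[m] is an R-regular sequence. -/
/-- `f 0, …, f (r-1)` is a regular sequence on `R`: each `f i` is a nonzerodivisor on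
`R/⟨f 0, …, f (i-1)⟩` and `⟨f 0, …, f (r-1)⟩ ≠ R`. -/
def IsRegularSeq {R : Type*} [CommRing R] {r : ℕ} (f : Fin r → R) : Prop :=
  (∀ i : Fin r, ∀ g : R,
      f i * g ∈ Ideal.span (f '' {j | j < i}) → g ∈ Ideal.span (f '' {j | j < i})) ∧
    Ideal.span (Set.range f) ≠ ⊤

namespace MvPolynomial

variable {σ R : Type*} [CommRing R]

open Classical in
/-- The coefficient of `X ^ ρ` when a polynomial is written as `∑ ρ, X ^ ρ * expand m (g ρ)`,
where `ρ` runs over the exponents all of whose entries are less than `m`. -/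
noncomputable def residuePart (m : ℕ) (ρ : σ → Fin m) :
    MvPolynomial σ R →ₗ[R] MvPolynomial σ R :=
  (basisMonomials σ R).constr R fun e =>
    if ∀ i, e i % m = ρ i then monomial (e.mapRange (· / m) (Nat.zero_div m)) 1 else 0

open Classical in
theorem residuePart_monomial (m : ℕ) (ρ : σ → Fin m) (e : σ →₀ ℕ) (a : R) :
    residuePart m ρ (monomial e a) =
      if ∀ i, e i % m = ρ i then monomial (e.mapRange (· / m) (Nat.zero_div m)) a else 0 := by
  have h : (monomial e a : MvPolynomial σ R) = a • basisMonomials σ R e := by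
    simp [smul_monomial]
  rw [h, map_smul, residuePart, Module.Basis.constr_basis]
  split_ifs <;> simp [smul_monomial]

theorem residuePart_expand_mul {m : ℕ} (hm : 0 < m) (ρ : σ → Fin m) (f g : MvPolynomial σ R) :
    residuePart m ρ (expand m f * g) = f * residuePart m ρ g := by
  induction f using MvPolynomial.induction_on' with
  | add p q hp hq => simp only [map_add, add_mul, hp, hq]
  | monomial d a =>
    induction g using MvPolynomial.induction_on' with
    | add p q hp hq => simp only [map_add, mul_add, hp, hq]
    | monomial e b =>
      have hdiv : (m • d + e).mapRange (· / m) (Nat.zero_div m) =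
          d + e.mapRange (· / m) (Nat.zero_div m) := by
        ext i
        simp [Nat.mul_add_div hm]
      simp only [expand_monomial, monomial_mul, residuePart_monomial, hdiv, Finsupp.add_apply,
        Finsupp.smul_apply, smul_eq_mul]
      rw [mul_ite, mul_zero, monomial_mul]
      congr 1
      simp only [Nat.mul_add_mod]

theorem residuePart_zero_one {m : ℕ} [NeZero m] :
    residuePart m (0 : σ → Fin m) (1 : MvPolynomial σ R) = 1 := by
  have h : (1 : MvPolynomial σ R) = monomial 0 1 := rfl
  rw [h, residuePart_monomial]
  simp

theorem sum_monomial_mul_expand_residuePart [Fintype σ] [DecidableEq σ] {m : ℕ} (hm : 0 < m)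
    (g : MvPolynomial σ R) :
    ∑ ρ : σ → Fin m, monomial (Finsupp.equivFunOnFinite.symm fun i => (ρ i : ℕ)) 1 *
      expand m (residuePart m ρ g) = g := by
  induction g using MvPolynomial.induction_on' with
  | add p q hp hq => simp only [map_add, mul_add, Finset.sum_add_distrib, hp, hq]
  | monomial e a =>
    rw [Finset.sum_eq_single fun i => ⟨e i % m, Nat.mod_lt _ hm⟩]
    · rw [residuePart_monomial, if_pos fun _ => rfl, expand_monomial, monomial_mul, one_mul]
      congr 2
      ext i
      simp [Nat.mod_add_div]
    · intro ρ _ hρ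
      rw [residuePart_monomial, if_neg, map_zero, mul_zero]
      exact fun h => hρ (_root_.funext fun i => Fin.ext (h i).symm)
    · simp

theorem mem_map_expand_iff [Finite σ] {m : ℕ} (hm : 0 < m) {I : Ideal (MvPolynomial σ R)}
    {g : MvPolynomial σ R} :
    g ∈ I.map (expand m) ↔ ∀ ρ : σ → Fin m, residuePart m ρ g ∈ I := by
  classical
  have := Fintype.ofFinite σ
  refine ⟨fun h ρ => ?_, fun h => ?_⟩
  · refine Submodule.closure_induction (p := fun x _ => residuePart m ρ x ∈ I) (by simp)
      (fun x y _ _ hx hy => by simpa using I.add_mem hx hy) ?_ h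
    rintro a _ ⟨f, hf, rfl⟩
    rw [smul_eq_mul, mul_comm, residuePart_expand_mul hm]
    exact I.mul_mem_right _ hf
  · rw [← sum_monomial_mul_expand_residuePart hm g]
    exact Ideal.sum_mem _ fun ρ _ => Ideal.mul_mem_left _ _ (Ideal.mem_map_of_mem _ (h ρ))

end MvPolynomial

/-- If `f_1, …, f_r` is an `R`-regular sequence in `R = K[X_1,…,X_n]`,
then for any `m ≥ 2` the sequence `f_1^[m], …, f_r^[m]` is an `R`-regular sequence. -/
theorem isRegularSeq_sqPoly (n : ℕ) (K : Type*) [Field K] (m : ℕ) (hm : 2 ≤ m)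
    (r : ℕ) (f : Fin r → MvPolynomial (Fin n) K) (hf : IsRegularSeq f) :
    IsRegularSeq (fun i => sqPoly m (f i)) := by
  have hm₀ : 0 < m := by omega
  have : NeZero m := ⟨hm₀.ne'⟩
  have hsq (g : MvPolynomial (Fin n) K) : sqPoly m g = MvPolynomial.expand m g := rfl
  simp only [hsq]
  refine ⟨fun i g hg => ?_, fun htop => hf.2 ?_⟩
  · rw [← Set.image_image (MvPolynomial.expand m) f, ← Ideal.map_span,
      MvPolynomial.mem_map_expand_iff hm₀] at hg ⊢
    intro ρ
    have h := hg ρ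
    rw [MvPolynomial.residuePart_expand_mul hm₀] at h
    exact hf.1 i _ h
  · rw [Set.range_comp' (MvPolynomial.expand m) f, ← Ideal.map_span, Ideal.eq_top_iff_one,
      MvPolynomial.mem_map_expand_iff hm₀] at htop
    rw [Ideal.eq_top_iff_one, ← MvPolynomial.residuePart_zero_one (m := m)]
    exact htop 0
end

section
/- Let I and J be monomial ideals of R and m ≥ 2 an integer. Then (I ∩ J)^[m] = I^[m] ∩ J^[m]. -/
/-- A monomial ideal: an ideal generated by a set of monomials `X^a`. -/
def IsMonomialIdeal {n : ℕ} {K : Type*} [Field K] (I : Ideal (MvPolynomial (Fin n) K)) : Prop :=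
  ∃ A : Set (Fin n →₀ ℕ), I = Ideal.span ((fun a => (MvPolynomial.monomial a (1 : K))) '' A)

/-- The intersection of two monomial ideals is generated by the pairwise least common multiples
of their generators. -/
theorem MvPolynomial.span_monomial_inf_span_monomial {σ R : Type*} [CommSemiring R]
    (A B : Set (σ →₀ ℕ)) :
    Ideal.span ((fun a => MvPolynomial.monomial a (1 : R)) '' A) ⊓
        Ideal.span ((fun a => MvPolynomial.monomial a (1 : R)) '' B) =
      Ideal.span ((fun a => MvPolynomial.monomial a (1 : R)) '' Set.image2 (· ⊔ ·) A B) := by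
  ext f
  simp only [Ideal.mem_inf, MvPolynomial.mem_ideal_span_monomial_image, Set.exists_mem_image2,
    sup_le_iff, ← forall₂_and]
  refine forall₂_congr fun d _ => ?_
  constructor
  · rintro ⟨⟨a, ha, had⟩, b, hb, hbd⟩
    exact ⟨a, ha, b, hb, had, hbd⟩
  · rintro ⟨a, ha, b, hb, had, hbd⟩
    exact ⟨⟨a, ha, had⟩, b, hb, hbd⟩

/-- The `m`-th square power of a monomial ideal is generated by the `m`-th powers of its monomial
generators. -/
theorem sqPow_span_monomial {n : ℕ} {K : Type*} [Field K] (m : ℕ) (A : Set (Fin n →₀ ℕ)) :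
    sqPow m (Ideal.span ((fun a => MvPolynomial.monomial a (1 : K)) '' A)) =
      Ideal.span ((fun a => MvPolynomial.monomial a (1 : K)) '' ((m • ·) '' A)) := by
  rw [sqPow, Ideal.map_span, Set.image_image, Set.image_image]
  congr 1
  refine Set.image_congr fun a _ => ?_
  exact MvPolynomial.expand_monomial m a 1

/-- For monomial ideals `I`, `J` and `m ≥ 2`,
`(I ∩ J)^[m] = I^[m] ∩ J^[m]`. -/
theorem sqPow_inf (n : ℕ) (K : Type*) [Field K]
    (I J : Ideal (MvPolynomial (Fin n) K))
    (hI : IsMonomialIdeal I) (hJ : IsMonomialIdeal J) (m : ℕ) (hm : 2 ≤ m) :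
    sqPow m (I ⊓ J) = sqPow m I ⊓ sqPow m J := by
  obtain ⟨A, rfl⟩ := hI
  obtain ⟨B, rfl⟩ := hJ
  rw [MvPolynomial.span_monomial_inf_span_monomial, sqPow_span_monomial, sqPow_span_monomial,
    sqPow_span_monomial, MvPolynomial.span_monomial_inf_span_monomial,
    Set.image_image2_distrib (f := (· ⊔ ·)) (f' := (· ⊔ ·))]
  intro a b
  ext i
  simp [Nat.mul_max_mul_left]
end

section
/- Let I ⊆ R be a monomial ideal with primary decomposition I = Q_1 ∩ ⋯ ∩ Q_r into primary monomial ideals. Then for all m ≥ 2, I^[m] = Q_1^[m] ∩ ⋯ ∩ Q_r^[m] is a primary decomposition of I^[m]; moreover Ass(R/I) = Ass(R/I^[m]) and Min(I) = Min(I^[m]) for all m ≥ 2. -/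
namespace MvPolynomial

variable {σ : Type*} {n m : ℕ} {K : Type*} [Field K]

/-- An ideal is closed under taking terms if it contains every monomial occurring in one of its
elements. -/
def TermClosed (I : Ideal (MvPolynomial σ K)) : Prop :=
  ∀ f ∈ I, ∀ a ∈ f.support, monomial a (1 : K) ∈ I

theorem mem_of_forall_mem_support {I : Ideal (MvPolynomial σ K)} {f : MvPolynomial σ K}
    (h : ∀ a ∈ f.support, monomial a (1 : K) ∈ I) : f ∈ I := by
  rw [← f.support_sum_monomial_coeff]
  refine Ideal.sum_mem _ fun a ha => ?_
  have := I.mul_mem_left (C (f.coeff a)) (h a ha)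
  rwa [C_mul_monomial, mul_one] at this

theorem TermClosed.le_of_monomial_mem {I J : Ideal (MvPolynomial σ K)} (hI : TermClosed I)
    (h : ∀ a, monomial a (1 : K) ∈ I → monomial a (1 : K) ∈ J) : I ≤ J := fun f hf =>
  mem_of_forall_mem_support fun a ha => h a (hI f hf a ha)

theorem monomial_mem_of_le {I : Ideal (MvPolynomial σ K)} {a b : σ →₀ ℕ} (hab : a ≤ b)
    (h : monomial a (1 : K) ∈ I) : monomial b (1 : K) ∈ I := by
  obtain ⟨c, rfl⟩ := exists_add_of_le hab
  have := I.mul_mem_right (monomial c 1) h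
  rwa [monomial_mul, mul_one] at this

theorem termClosed_of_isMonomialIdeal {I : Ideal (MvPolynomial (Fin n) K)}
    (hI : IsMonomialIdeal I) : TermClosed I := by
  obtain ⟨A, rfl⟩ := hI
  intro f hf a ha
  rw [mem_ideal_span_monomial_image] at hf ⊢
  intro b hb
  obtain rfl : a = b := by
    by_contra hab
    simp [coeff_monomial, hab] at hb
  exact hf a ha

theorem TermClosed.colon_monomial {I : Ideal (MvPolynomial σ K)} (hI : TermClosed I)
    (b : σ →₀ ℕ) : TermClosed (I.colon {monomial b (1 : K)}) := by
  intro f hf a ha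
  rw [Submodule.mem_colon_singleton, smul_eq_mul] at hf ⊢
  rw [monomial_mul, one_mul]
  refine hI _ hf _ ?_
  rw [mem_support_iff] at ha ⊢
  rwa [coeff_mul_monomial, mul_one]

/-- Every polynomial is the sum of its terms outside an ideal `P` and its terms inside `P`. -/
theorem exists_eq_add_support (P : Ideal (MvPolynomial σ K)) (g : MvPolynomial σ K) :
    ∃ g₀ g₁, g = g₀ + g₁ ∧ (∀ a ∈ g₀.support, monomial a (1 : K) ∉ P) ∧
      ∀ a ∈ g₁.support, monomial a (1 : K) ∈ P := by
  classical
  refine ⟨∑ a ∈ g.support with monomial a (1 : K) ∉ P, monomial a (g.coeff a),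
    ∑ a ∈ g.support with monomial a (1 : K) ∈ P, monomial a (g.coeff a), ?_, ?_, ?_⟩
  · rw [add_comm, Finset.sum_filter_add_sum_filter_not, support_sum_monomial_coeff]
  all_goals
    intro a ha
    by_contra haP
    rw [mem_support_iff, coeff_sum] at ha
    refine ha (Finset.sum_eq_zero fun b hb => ?_)
    rw [coeff_monomial, if_neg]
    rintro rfl
    simp_all

theorem monomial_nsmul_mem_iff_pow {I : Ideal (MvPolynomial σ K)} {a : σ →₀ ℕ} {N : ℕ} :
    monomial (N • a) (1 : K) ∈ I ↔ monomial a (1 : K) ^ N ∈ I := by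
  rw [monomial_pow, one_pow]

theorem TermClosed.radical {I : Ideal (MvPolynomial (Fin n) K)} (hI : TermClosed I) :
    TermClosed I.radical := by
  intro g hg
  obtain ⟨g₀, g₁, rfl, hg₀, hg₁⟩ := exists_eq_add_support I.radical g
  have hmem : g₀ ∈ I.radical := (Ideal.add_mem_iff_left _ (mem_of_forall_mem_support hg₁)).1 hg
  by_cases h0 : g₀ = 0
  · rwa [h0, zero_add]
  · obtain ⟨N, hN⟩ := hmem
    have hd := hI _ hN _
      ((MonomialOrder.lex (σ := Fin n)).degree_mem_support (pow_ne_zero N h0))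
    rw [MonomialOrder.degree_pow, monomial_nsmul_mem_iff_pow] at hd
    exact absurd ⟨N, hd⟩ (hg₀ _ (MonomialOrder.degree_mem_support h0))

/-- For an ideal closed under taking terms, being primary can be tested on monomials. -/
theorem TermClosed.isPrimary {J : Ideal (MvPolynomial (Fin n) K)} (hJ : TermClosed J)
    (hne : J ≠ ⊤) (h : ∀ a b, monomial (a + b) (1 : K) ∈ J → monomial a (1 : K) ∉ J →
      monomial b (1 : K) ∈ J.radical) : J.IsPrimary := by
  refine Ideal.isPrimary_iff.2 ⟨hne, fun {f g} hfg => ?_⟩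
  obtain ⟨f₀, f₁, rfl, hf₀, hf₁⟩ := exists_eq_add_support J f
  obtain ⟨g₀, g₁, rfl, hg₀, hg₁⟩ := exists_eq_add_support J.radical g
  have hf₁J := mem_of_forall_mem_support hf₁
  have hg₁J := mem_of_forall_mem_support hg₁
  rw [Ideal.add_mem_iff_left _ hf₁J, Ideal.add_mem_iff_left _ hg₁J]
  by_cases hf : f₀ = 0
  · exact .inl (hf ▸ J.zero_mem)
  by_cases hg : g₀ = 0
  · exact .inr (hg ▸ J.radical.zero_mem)
  rw [add_mul, Ideal.add_mem_iff_left _ (J.mul_mem_right _ hf₁J)] at hfg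
  obtain ⟨N, hN⟩ := hg₁J
  have hmem : f₀ * g₀ ^ N ∈ J := by
    obtain ⟨k, hk⟩ := sub_dvd_pow_sub_pow g₀ (-g₁) N
    have key : f₀ * g₀ ^ N = f₀ * (g₀ + g₁) * k + f₀ * (-1) ^ N * g₁ ^ N := by
      rw [sub_neg_eq_add, neg_pow, sub_eq_iff_eq_add] at hk
      rw [hk]
      ring
    rw [key]
    exact J.add_mem (J.mul_mem_right _ hfg) (J.mul_mem_left _ hN)
  let o := MonomialOrder.lex (σ := Fin n)
  have hd := hJ _ hmem _ (o.degree_mem_support (mul_ne_zero hf (pow_ne_zero N hg)))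
  rw [MonomialOrder.degree_mul hf (pow_ne_zero N hg), MonomialOrder.degree_pow] at hd
  have hr := h _ _ hd (hf₀ _ (o.degree_mem_support hf))
  rw [monomial_nsmul_mem_iff_pow] at hr
  exact absurd (J.radical_isRadical ⟨N, hr⟩) (hg₀ _ (o.degree_mem_support hg))

theorem mem_associatedPrimes_quotient_iff {R : Type*} [CommRing R] {I p : Ideal R} :
    p ∈ associatedPrimes R (R ⧸ I) ↔ p.IsPrime ∧ ∃ f, p = (I.colon {f}).radical := by
  have key (f : R) : (⊥ : Submodule R (R ⧸ I)).colon {Ideal.Quotient.mk I f} = I.colon {f} := by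
    ext r
    rw [Submodule.mem_colon_singleton, Submodule.mem_colon_singleton, Submodule.mem_bot,
      smul_eq_mul, ← Ideal.Quotient.eq_zero_iff_mem, map_mul, Algebra.smul_def]
    rfl
  rw [AssociatedPrimes.mem_iff, IsAssociatedPrime, Submodule.isAssociatedPrime_def,
    Ideal.Quotient.mk_surjective.exists]
  simp only [key]

/-- Associated primes of a primary decomposition are radicals of its components. -/
theorem exists_eq_radical_of_mem_associatedPrimes {R ι : Type*} [CommRing R] [Finite ι]
    {I p : Ideal R} {Q : ι → Ideal R} (hQ : ∀ i, (Q i).IsPrimary) (hI : I = ⨅ i, Q i)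
    (hp : p ∈ associatedPrimes R (R ⧸ I)) : ∃ i, p = (Q i).radical := by
  have := Fintype.ofFinite ι
  obtain ⟨hprime, f, hf⟩ := mem_associatedPrimes_quotient_iff.1 hp
  have hle : Finset.univ.inf (fun i => (Q i).colon {f}) ≤ p := by
    intro r hr
    rw [hf]
    refine Ideal.le_radical ?_
    rw [Submodule.mem_colon_singleton, hI, Ideal.mem_iInf]
    exact fun i => Submodule.mem_colon_singleton.1
      (Finset.inf_le (f := fun i => (Q i).colon {f}) (Finset.mem_univ i) hr)
  obtain ⟨i, -, hi⟩ := hprime.inf_le'.1 hle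
  have hfi : f ∉ Q i := fun hfi => hprime.ne_top <| (Ideal.eq_top_iff_one p).2 <| hi <| by
    rwa [Submodule.mem_colon_singleton, one_smul]
  refine ⟨i, le_antisymm (fun x hx => ?_) ?_⟩
  · rw [hf] at hx
    obtain ⟨N, hN⟩ := hx
    rw [Submodule.mem_colon_singleton, hI, Ideal.mem_iInf, smul_eq_mul] at hN
    exact (Q i).radical_isRadical
      ⟨N, ((Ideal.isPrimary_iff.1 (hQ i)).2 (mul_comm _ f ▸ hN i)).resolve_left hfi⟩
  · refine hprime.radical_le_iff.2 fun x hx => hi ?_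
    rw [Submodule.mem_colon_singleton, smul_eq_mul]
    exact (Q i).mul_mem_right _ hx

/-- An associated prime of a monomial ideal is the radical of a colon ideal by a monomial. -/
theorem TermClosed.mem_associatedPrimes_iff {ι : Type*} [Finite ι]
    {I p : Ideal (MvPolynomial (Fin n) K)} {Q : ι → Ideal (MvPolynomial (Fin n) K)}
    (hI : TermClosed I) (hQ : ∀ i, TermClosed (Q i)) (hprim : ∀ i, (Q i).IsPrimary)
    (hdec : I = ⨅ i, Q i) :
    p ∈ associatedPrimes _ (MvPolynomial (Fin n) K ⧸ I) ↔
      p.IsPrime ∧ ∃ a, p = (I.colon {monomial a (1 : K)}).radical := by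
  refine ⟨fun hp => ?_, fun ⟨hp, a, ha⟩ => mem_associatedPrimes_quotient_iff.2 ⟨hp, _, ha⟩⟩
  have hterm : TermClosed p := by
    obtain ⟨i, rfl⟩ := exists_eq_radical_of_mem_associatedPrimes hprim hdec hp
    exact (hQ i).radical
  obtain ⟨hprime, f, hf⟩ := mem_associatedPrimes_quotient_iff.1 hp
  have hle : f.support.inf (fun a => I.colon {monomial a (1 : K)}) ≤ p := by
    intro r hr
    rw [hf]
    refine Ideal.le_radical ?_
    rw [Submodule.mem_colon_singleton, smul_eq_mul, ← f.support_sum_monomial_coeff,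
      Finset.mul_sum]
    refine Ideal.sum_mem _ fun a ha => ?_
    have hra := Submodule.mem_colon_singleton.1
      (Finset.inf_le (f := fun a => I.colon {monomial a (1 : K)}) ha hr)
    have := I.mul_mem_left (C (f.coeff a)) hra
    rwa [smul_eq_mul, mul_left_comm, C_mul_monomial, mul_one] at this
  obtain ⟨a, ha, hap⟩ := hprime.inf_le'.1 hle
  refine ⟨hprime, a, le_antisymm (hterm.le_of_monomial_mem fun c hc => ?_)
    (hprime.radical_le_iff.2 hap)⟩
  rw [hf] at hc
  obtain ⟨N, hN⟩ := hc
  refine ⟨N, ?_⟩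
  rw [Submodule.mem_colon_singleton, smul_eq_mul, monomial_pow, one_pow] at hN ⊢
  rw [monomial_mul, one_mul]
  refine hI _ hN _ ?_
  rw [mem_support_iff] at ha ⊢
  rwa [coeff_monomial_mul, one_mul]

/-- Componentwise division of an exponent vector by `m`, rounded down. -/
noncomputable def divExponent (m : ℕ) (a : σ →₀ ℕ) : σ →₀ ℕ :=
  a.mapRange (· / m) (Nat.zero_div m)

theorem divExponent_apply (a : σ →₀ ℕ) (i : σ) : divExponent m a i = a i / m :=
  Finsupp.mapRange_apply

theorem divExponent_add_nsmul (hm : 0 < m) (a b : σ →₀ ℕ) :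
    divExponent m (a + m • b) = divExponent m a + b := by
  ext i
  simp [divExponent_apply, Nat.add_mul_div_left _ _ hm]

theorem divExponent_nsmul (hm : 0 < m) (b : σ →₀ ℕ) : divExponent m (m • b) = b := by
  ext i
  simp [divExponent_apply, Nat.mul_div_cancel_left _ hm]

theorem nsmul_le_iff_le_divExponent (hm : 0 < m) {a b : σ →₀ ℕ} :
    m • a ≤ b ↔ a ≤ divExponent m b := by
  refine forall_congr' fun i => ?_
  rw [divExponent_apply, Nat.le_div_iff_mul_le hm, mul_comm]
  simp

theorem divExponent_add_le (hm : 0 < m) (a b : σ →₀ ℕ) :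
    divExponent m (a + b) ≤ divExponent m a + b := by
  rw [← divExponent_add_nsmul hm]
  intro i
  rw [divExponent_apply, divExponent_apply]
  refine Nat.div_le_div_right ?_
  simpa using Nat.le_mul_of_pos_left _ hm

section sqPow

variable {I : Ideal (MvPolynomial (Fin n) K)}

theorem _root_.IsMonomialIdeal.mem_sqPow_iff (hI : IsMonomialIdeal I) (hm : 0 < m)
    {f : MvPolynomial (Fin n) K} :
    f ∈ sqPow m I ↔ ∀ b ∈ f.support, monomial (divExponent m b) (1 : K) ∈ I := by
  classical
  obtain ⟨A, rfl⟩ := hI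
  have himg : (fun a => aeval (fun i => (X i : MvPolynomial (Fin n) K) ^ m)
      (monomial a (1 : K))) '' A =
        (fun a => monomial a (1 : K)) '' ((fun a => m • a) '' A) := by
    rw [Set.image_image]
    exact Set.image_congr fun a _ => expand_monomial m a 1
  rw [sqPow, Ideal.map_span, Set.image_image, himg, mem_ideal_span_monomial_image]
  refine forall₂_congr fun b _ => ?_
  rw [mem_ideal_span_monomial_image, support_monomial, if_neg one_ne_zero]
  simp [nsmul_le_iff_le_divExponent hm]

theorem _root_.IsMonomialIdeal.monomial_mem_sqPow_iff (hI : IsMonomialIdeal I) (hm : 0 < m)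
    {b : Fin n →₀ ℕ} :
    monomial b (1 : K) ∈ sqPow m I ↔ monomial (divExponent m b) (1 : K) ∈ I := by
  classical
  rw [hI.mem_sqPow_iff hm, support_monomial, if_neg one_ne_zero]
  simp

theorem _root_.IsMonomialIdeal.termClosed_sqPow (hI : IsMonomialIdeal I) (hm : 0 < m) :
    TermClosed (sqPow m I) := fun _ hf a ha =>
  (hI.monomial_mem_sqPow_iff hm).2 ((hI.mem_sqPow_iff hm).1 hf a ha)

/-- Colon ideals by monomials of `I^[m]` and of `I` have the same radical. -/
theorem _root_.IsMonomialIdeal.radical_colon_sqPow (hI : IsMonomialIdeal I) (hm : 0 < m)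
    (b : Fin n →₀ ℕ) :
    ((sqPow m I).colon {monomial b (1 : K)}).radical =
      (I.colon {monomial (divExponent m b) (1 : K)}).radical := by
  apply le_antisymm <;> refine Ideal.radical_le_radical_iff.2 ?_
  · refine ((hI.termClosed_sqPow hm).colon_monomial b).le_of_monomial_mem fun c hc =>
      Ideal.le_radical ?_
    rw [Submodule.mem_colon_singleton, smul_eq_mul, monomial_mul, one_mul] at hc ⊢
    rw [hI.monomial_mem_sqPow_iff hm, add_comm] at hc
    rw [add_comm]
    exact monomial_mem_of_le (divExponent_add_le hm b c) hc
  · refine ((termClosed_of_isMonomialIdeal hI).colon_monomial _).le_of_monomial_mem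
      fun c hc => ⟨m, ?_⟩
    rw [Submodule.mem_colon_singleton, smul_eq_mul] at hc ⊢
    rw [monomial_mul, one_mul] at hc
    rwa [monomial_pow, one_pow, monomial_mul, one_mul, hI.monomial_mem_sqPow_iff hm, add_comm,
      divExponent_add_nsmul hm, add_comm]

theorem _root_.IsMonomialIdeal.radical_sqPow (hI : IsMonomialIdeal I) (hm : 0 < m) :
    (sqPow m I).radical = I.radical := by
  have hcolon (J : Ideal (MvPolynomial (Fin n) K)) : J.colon {monomial 0 (1 : K)} = J := by
    ext r
    rw [Submodule.mem_colon_singleton, smul_eq_mul, monomial_zero', C_1, mul_one]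
  have h0 : divExponent m (0 : Fin n →₀ ℕ) = 0 := Finsupp.mapRange_zero
  simpa only [h0, hcolon] using hI.radical_colon_sqPow hm 0

theorem _root_.IsMonomialIdeal.isPrimary_sqPow (hI : IsMonomialIdeal I) (hm : 0 < m)
    (hprim : I.IsPrimary) : (sqPow m I).IsPrimary := by
  rw [Ideal.isPrimary_iff] at hprim
  refine (hI.termClosed_sqPow hm).isPrimary ?_ fun a b hab ha => ?_
  · rw [Ne, ← Ideal.radical_eq_top, hI.radical_sqPow hm, Ideal.radical_eq_top]
    exact hprim.1
  · rw [hI.monomial_mem_sqPow_iff hm] at hab ha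
    rw [hI.radical_sqPow hm]
    refine (hprim.2 (x := monomial (divExponent m a) 1) ?_).resolve_left ha
    rw [monomial_mul, one_mul]
    exact monomial_mem_of_le (divExponent_add_le hm a b) hab

theorem sqPow_iInf {ι : Type*} {Q : ι → Ideal (MvPolynomial (Fin n) K)}
    (hI : IsMonomialIdeal I) (hQ : ∀ i, IsMonomialIdeal (Q i)) (hdec : I = ⨅ i, Q i)
    (hm : 0 < m) : sqPow m I = ⨅ i, sqPow m (Q i) := by
  ext f
  simp only [Ideal.mem_iInf, hI.mem_sqPow_iff hm, (hQ _).mem_sqPow_iff hm]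
  simp only [hdec, Ideal.mem_iInf]
  exact ⟨fun h i b hb => h b hb i, fun h b hb i => h i b hb⟩

end sqPow

end MvPolynomial

/-- Let `I` be a monomial ideal with primary decomposition
`I = Q_1 ∩ ⋯ ∩ Q_r` into primary monomial ideals. Then for all `m ≥ 2`,
`I^[m] = Q_1^[m] ∩ ⋯ ∩ Q_r^[m]` is a primary decomposition of `I^[m]`; moreover
`Ass(R/I) = Ass(R/I^[m])` and `Min(I) = Min(I^[m])`. -/
theorem sqPow_primary_decomposition (n : ℕ) (K : Type*) [Field K]
    (r : ℕ) (hr : 0 < r) (Q : Fin r → Ideal (MvPolynomial (Fin n) K))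
    (hQmono : ∀ i, IsMonomialIdeal (Q i)) (hQprim : ∀ i, (Q i).IsPrimary)
    (I : Ideal (MvPolynomial (Fin n) K)) (hImono : IsMonomialIdeal I)
    (hIdec : I = ⨅ i, Q i) (m : ℕ) (hm : 2 ≤ m) :
    sqPow m I = ⨅ i, sqPow m (Q i) ∧
      (∀ i, (sqPow m (Q i)).IsPrimary) ∧
      associatedPrimes (MvPolynomial (Fin n) K) (MvPolynomial (Fin n) K ⧸ I) =
        associatedPrimes (MvPolynomial (Fin n) K) (MvPolynomial (Fin n) K ⧸ sqPow m I) ∧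
      I.minimalPrimes = (sqPow m I).minimalPrimes := by
  have hm0 : 0 < m := by omega
  have hinf := MvPolynomial.sqPow_iInf hImono hQmono hIdec hm0
  have hprim i := (hQmono i).isPrimary_sqPow hm0 (hQprim i)
  refine ⟨hinf, hprim, ?_, ?_⟩
  · ext p
    rw [(MvPolynomial.termClosed_of_isMonomialIdeal hImono).mem_associatedPrimes_iff
        (fun i => MvPolynomial.termClosed_of_isMonomialIdeal (hQmono i)) hQprim hIdec,
      (hImono.termClosed_sqPow hm0).mem_associatedPrimes_iff
        (fun i => (hQmono i).termClosed_sqPow hm0) hprim hinf]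
    simp only [hImono.radical_colon_sqPow hm0]
    refine and_congr_right fun _ => ⟨fun ⟨a, ha⟩ => ⟨m • a, ?_⟩, fun ⟨b, hb⟩ => ⟨_, hb⟩⟩
    rwa [MvPolynomial.divExponent_nsmul hm0]
  · rw [← Ideal.radical_minimalPrimes, ← (sqPow m I).radical_minimalPrimes,
      hImono.radical_sqPow hm0]
end
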